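/- Let λ > 0, s > 1/2 and n ≥ 1. Suppose Λ ∈ ℂ^{n×n} is a diagonal matrix whose diagonal entries λ_j satisfy |λ_j| ≤ λ for all 1 ≤ j ≤ n, and let g(z) = exp(½⟨Λz, z⟩) for z ∈ ℝ^n, where ⟨Λz, z⟩ = Σ_{j} λ_j z_j². Then for each μ > 0 there exists δ with 0 < δ ≤ 1 such that, provided λ ≤ δ, for every h > 0 there is a constant C > 0 with |∂^α g(z)| ≤ C h^{|α|} (α!)^s exp(μ h^{−1/s} |z|^{1/s}) · |exp(½⟨Λz, z⟩)| for all z ∈ ℝ^n and all multi-indices α ∈ ℕ^n. -/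

import Mathlib

open scoped Nat

/-- Partial derivative in the `j`-th coordinate direction. -/
noncomputable def pd {n : ℕ} (j : Fin n) (f : EuclideanSpace ℝ (Fin n) → ℂ) :
    EuclideanSpace ℝ (Fin n) → ℂ :=
  fun z => fderiv ℝ f z (EuclideanSpace.single j 1)

/-- Iterated partial derivative `∂^α` for a multi-index `α ∈ ℕ^n`. -/
noncomputable def pdMulti {n : ℕ} (α : Fin n → ℕ) (f : EuclideanSpace ℝ (Fin n) → ℂ) :
    EuclideanSpace ℝ (Fin n) → ℂ :=
  (List.finRange n).foldr (fun j g => (pd j)^[α j] g) f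

namespace GaussEst

/-- `∂^k exp(λ t²/2) = P k λ t * exp(λ t²/2)`. -/
noncomputable def P : ℕ → ℂ → ℂ → ℂ
  | 0, _, _ => 1
  | 1, l, t => l * t
  | (k + 2), l, t => l * t * P (k + 1) l t + (k + 1) * l * P k l t

lemma P_rec (k : ℕ) (l t : ℂ) : P (k + 1) l t = l * t * P k l t + k * l * P (k - 1) l t := by
  cases k with
  | zero => simp [P]
  | succ k => simp [P]

lemma P_deriv (k : ℕ) (l t : ℂ) : HasDerivAt (P k l) (k * l * P (k - 1) l t) t := by
  induction k using Nat.strong_induction_on with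
  | _ k ih =>
    match k, ih with
    | 0, _ =>
      have : P 0 l = fun _ => 1 := by funext t; simp [P]
      rw [this]; simpa using hasDerivAt_const t (1 : ℂ)
    | 1, _ =>
      have : P 1 l = fun t => l * t := by funext t; simp [P]
      rw [this]; simpa [P] using (hasDerivAt_id t).const_mul l
    | k + 2, ih =>
      have h1 := ih (k + 1) (by omega)
      have h0 := ih k (by omega)
      have : P (k + 2) l = fun t => l * t * P (k + 1) l t + (k + 1) * l * P k l t := by
        funext t; simp [P]
      rw [this]
      have h2 := (((hasDerivAt_id t).const_mul l).mul h1).add (h0.const_mul ((k + 1) * l))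
      refine h2.congr_deriv ?_
      have := P_rec k l t
      simp only [Nat.add_sub_cancel, id, mul_one, show k + 2 - 1 = k + 1 by omega]
      rw [this]
      push_cast
      ring

/-- One dimensional factor. -/
noncomputable def G (k : ℕ) (l t : ℂ) : ℂ := P k l t * Complex.exp ((1 / 2 : ℂ) * (l * t ^ 2))

lemma G_deriv (k : ℕ) (l t : ℂ) : HasDerivAt (G k l) (G (k + 1) l t) t := by
  have h1 := ((((hasDerivAt_id t).pow 2).const_mul l).const_mul (1 / 2 : ℂ)).cexp
  have h2 := (P_deriv k l t).mul h1
  refine h2.congr_deriv ?_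
  simp only [G, P_rec k l t, id, Pi.pow_apply]
  push_cast
  ring

/-- The product of one dimensional factors. -/
noncomputable def M {n : ℕ} (Λ : Fin n → ℂ) (β : Fin n → ℕ) (w : EuclideanSpace ℝ (Fin n)) : ℂ :=
  ∏ i, G (β i) (Λ i) (w i : ℂ)

lemma G_fderiv {n : ℕ} (k : ℕ) (l : ℂ) (i : Fin n) (z : EuclideanSpace ℝ (Fin n)) :
    HasFDerivAt (fun w : EuclideanSpace ℝ (Fin n) => G k l (w i : ℂ))
      ((EuclideanSpace.proj i : EuclideanSpace ℝ (Fin n) →L[ℝ] ℝ).smulRight (G (k + 1) l (z i : ℂ)))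
      z := by
  have h1 : HasDerivAt (fun t : ℝ => G k l (t : ℂ)) (G (k + 1) l (z i : ℂ)) (z i) :=
    (G_deriv k l (z i : ℂ)).comp_ofReal
  have h2 : HasFDerivAt (fun w : EuclideanSpace ℝ (Fin n) => w i)
      (EuclideanSpace.proj i : EuclideanSpace ℝ (Fin n) →L[ℝ] ℝ) z :=
    (EuclideanSpace.proj i : EuclideanSpace ℝ (Fin n) →L[ℝ] ℝ).hasFDerivAt
  have h3 := h1.hasFDerivAt.comp z h2
  refine h3.congr_fderiv ?_
  ext v
  simp

lemma pd_M {n : ℕ} (Λ : Fin n → ℂ) (β : Fin n → ℕ) (j : Fin n) :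
    pd j (M Λ β) = M Λ (Function.update β j (β j + 1)) := by
  funext z
  have h : HasFDerivAt (M Λ β) _ z :=
    HasFDerivAt.finsetProd (u := Finset.univ) (fun i _ => G_fderiv (β i) (Λ i) i z)
  unfold pd
  rw [h.fderiv]
  simp only [sum_apply, smul_apply,
    ContinuousLinearMap.smulRight_apply, M]
  rw [Finset.sum_eq_single j]
  · rw [← Finset.mul_prod_erase Finset.univ _ (Finset.mem_univ j)]
    have hj : (EuclideanSpace.proj j : EuclideanSpace ℝ (Fin n) →L[ℝ] ℝ)
        (EuclideanSpace.single j 1) = 1 := by simp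
    rw [hj, one_smul, Function.update_self, smul_eq_mul, mul_comm]
    congr 1
    refine Finset.prod_congr rfl fun i hi => ?_
    rw [Function.update_of_ne (Finset.ne_of_mem_erase hi)]
  · intro b _ hb
    simp [hb]
  · simp

lemma pd_iter_M {n : ℕ} (Λ : Fin n → ℂ) (j : Fin n) (m : ℕ) (β : Fin n → ℕ) :
    (pd j)^[m] (M Λ β) = M Λ (Function.update β j (β j + m)) := by
  induction m generalizing β with
  | zero => simp
  | succ m ih =>
    rw [Function.iterate_succ_apply, pd_M, ih]
    simp only [Function.update_self, Function.update_idem]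
    congr 2
    ring

lemma foldr_M {n : ℕ} (Λ : Fin n → ℂ) (α : Fin n → ℕ) (L : List (Fin n)) (hL : L.Nodup) :
    L.foldr (fun j g => (pd j)^[α j] g) (M Λ 0) = M Λ (fun i => if i ∈ L then α i else 0) := by
  induction L with
  | nil => simp; rfl
  | cons a L ih =>
    rw [List.nodup_cons] at hL
    rw [List.foldr_cons, ih hL.2, pd_iter_M]
    congr 1
    funext i
    by_cases hi : i = a
    · subst hi; simp [hL.1]
    · simp [Function.update_of_ne hi, hi]

lemma pdMulti_eq {n : ℕ} (Λ : Fin n → ℂ) (α : Fin n → ℕ) (z : EuclideanSpace ℝ (Fin n)) :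
    pdMulti α (fun w => Complex.exp ((1 / 2 : ℂ) * ∑ j, Λ j * (w j : ℂ) ^ 2)) z =
      (∏ i, P (α i) (Λ i) (z i)) * Complex.exp ((1 / 2 : ℂ) * ∑ j, Λ j * (z j : ℂ) ^ 2) := by
  have h0 : (fun w : EuclideanSpace ℝ (Fin n) =>
      Complex.exp ((1 / 2 : ℂ) * ∑ j, Λ j * (w j : ℂ) ^ 2)) = M Λ 0 := by
    funext w
    simp [M, G, P, Finset.mul_sum, Complex.exp_sum]
  rw [h0, pdMulti, foldr_M _ _ _ (List.nodup_finRange n)]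
  simp [M, G, Finset.prod_mul_distrib, Finset.mul_sum, Complex.exp_sum]

/-- Coefficients of `exp(X²/2)`. -/
noncomputable def v : ℕ → ℝ
  | 0 => 1
  | 1 => 0
  | (i + 2) => v i / (i + 2)

lemma v_nonneg (i : ℕ) : 0 ≤ v i := by
  induction i using Nat.strong_induction_on with
  | _ i ih =>
    match i, ih with
    | 0, _ => simp [v]
    | 1, _ => simp [v]
    | i + 2, ih =>
      have := ih i (by omega)
      simp only [v]; positivity

open PowerSeries in
/-- `exp(aX + X²/2)`. -/
noncomputable def F (a : ℝ) : PowerSeries ℝ :=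
  PowerSeries.mk (fun j => a ^ j / (j ! : ℝ)) * PowerSeries.mk v

lemma F_deriv (a : ℝ) : PowerSeries.derivative ℝ (F a) =
    PowerSeries.C a * F a + PowerSeries.X * F a := by
  have hU : PowerSeries.derivative ℝ (PowerSeries.mk (fun j => a ^ j / (j ! : ℝ))) =
      PowerSeries.C a * PowerSeries.mk (fun j => a ^ j / (j ! : ℝ)) := by
    ext j
    simp [PowerSeries.coeff_derivative, Nat.factorial_succ]
    field_simp
    ring
  have hV : PowerSeries.derivative ℝ (PowerSeries.mk v) = PowerSeries.X * PowerSeries.mk v := by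
    ext j
    cases j with
    | zero => simp [PowerSeries.coeff_derivative, v]
    | succ j =>
      simp [PowerSeries.coeff_derivative, PowerSeries.coeff_succ_X_mul, v]
      field_simp
      ring
  unfold F
  rw [Derivation.leibniz, hU, hV]
  simp only [smul_eq_mul]
  ring

lemma F_rec0 (a : ℝ) : PowerSeries.coeff 0 (F a) = 1 := by
  simp [F, v]

lemma F_rec1 (a : ℝ) : PowerSeries.coeff 1 (F a) = a := by
  have := congrArg (PowerSeries.coeff 0) (F_deriv a)
  rw [PowerSeries.coeff_derivative] at this
  simp [F, v] at this
  simpa [F] using this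

lemma F_rec2 (a : ℝ) (k : ℕ) : ((k : ℝ) + 2) * PowerSeries.coeff (k + 2) (F a) =
    a * PowerSeries.coeff (k + 1) (F a) + PowerSeries.coeff k (F a) := by
  have := congrArg (PowerSeries.coeff (k + 1)) (F_deriv a)
  rw [PowerSeries.coeff_derivative, map_add, PowerSeries.coeff_C_mul,
    PowerSeries.coeff_succ_X_mul] at this
  rw [← this]; push_cast; ring

lemma F_coeff (a : ℝ) (k : ℕ) : PowerSeries.coeff k (F a) =
    ∑ p ∈ Finset.HasAntidiagonal.antidiagonal k, a ^ p.1 / (p.1 ! : ℝ) * v p.2 := by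
  simp [F, PowerSeries.coeff_mul]

lemma F_nonneg (a : ℝ) (ha : 0 ≤ a) (k : ℕ) : 0 ≤ PowerSeries.coeff k (F a) := by
  rw [F_coeff]
  refine Finset.sum_nonneg fun p _ => mul_nonneg (by positivity) (v_nonneg _)

lemma P_bound (l t : ℂ) (a : ℝ) (hl : ‖l‖ ≤ 1) (ha : ‖l * t‖ ≤ a) (k : ℕ) :
    ‖P k l t‖ ≤ (k ! : ℝ) * PowerSeries.coeff k (F a) := by
  have ha0 : 0 ≤ a := (norm_nonneg _).trans ha
  induction k using Nat.strong_induction_on with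
  | _ k ih =>
    match k, ih with
    | 0, _ => simp [P, F_rec0]
    | 1, _ => simpa [P, F_rec1] using ha
    | k + 2, ih =>
      have h1 := ih (k + 1) (by omega)
      have h0 := ih k (by omega)
      have e : ((k + 2)! : ℝ) * PowerSeries.coeff (k + 2) (F a) =
          a * (((k + 1)! : ℝ) * PowerSeries.coeff (k + 1) (F a)) +
          (k + 1) * 1 * ((k ! : ℝ) * PowerSeries.coeff k (F a)) := by
        have := F_rec2 a k
        rw [Nat.factorial_succ (k + 1), Nat.factorial_succ k]
        push_cast
        linear_combination ((k : ℝ) + 1) * (k ! : ℝ) * this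
      rw [e]
      simp only [P]
      refine (norm_add_le _ _).trans ?_
      rw [norm_mul (l * t), norm_mul (_ * l), norm_mul _ l]
      have hk : ‖(k : ℂ) + 1‖ = (k : ℝ) + 1 := by
        have := Complex.norm_natCast (k + 1)
        push_cast at this; exact this
      rw [hk]
      gcongr

lemma w_bdd (s B : ℝ) (hs : 1 / 2 < s) (hB : 0 < B) :
    ∃ C : ℝ, 0 < C ∧ ∀ i : ℕ, B ^ i * (i ! : ℝ) ^ (1 - s) * v i ≤ C := by
  set w : ℕ → ℝ := fun i => B ^ i * (i ! : ℝ) ^ (1 - s) * v i with hw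
  have w0 : ∀ i, 0 ≤ w i := fun i => mul_nonneg (by positivity) (v_nonneg i)
  obtain ⟨e, he, he1, he2⟩ : ∃ e : ℝ, 0 < e ∧ e ≤ 1 ∧ e ≤ 2 * s - 1 :=
    ⟨min 1 (2 * s - 1), lt_min one_pos (by linarith), min_le_left _ _, min_le_right _ _⟩
  have ht : Filter.Tendsto (fun i : ℕ => B ^ 2 * ((i : ℝ) + 2) ^ (-e)) Filter.atTop (nhds 0) := by
    have h1 : Filter.Tendsto (fun i : ℕ => (i : ℝ) + 2) Filter.atTop Filter.atTop :=
      Filter.tendsto_atTop_add_const_right _ _ tendsto_natCast_atTop_atTop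
    simpa using ((tendsto_rpow_neg_atTop he).comp h1).const_mul (B ^ 2)
  obtain ⟨N, hN⟩ := Filter.eventually_atTop.1 (ht.eventually (gt_mem_nhds one_pos))
  have step : ∀ i, N ≤ i → w (i + 2) ≤ w i := by
    intro i hi
    have h1 := (hN i hi).le
    have key : (((i : ℝ) + 2) * (i + 1)) ^ (1 - s) / (i + 2) ≤ ((i : ℝ) + 2) ^ (-e) := by
      have hi2 : (1 : ℝ) ≤ (i : ℝ) + 2 := by linarith [(Nat.cast_nonneg i : (0 : ℝ) ≤ i)]
      have hi1 : (1 : ℝ) ≤ (i : ℝ) + 1 := by linarith [(Nat.cast_nonneg i : (0 : ℝ) ≤ i)]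
      rw [div_le_iff₀ (by positivity)]
      have e1 : ((i : ℝ) + 2) ^ (-e) * (i + 2) = ((i : ℝ) + 2) ^ (1 - e) := by
        rw [show 1 - e = -e + 1 by ring, Real.rpow_add_one (by positivity)]
      rw [e1]
      rcases le_total s 1 with h | h
      · calc (((i : ℝ) + 2) * (i + 1)) ^ (1 - s) ≤ (((i : ℝ) + 2) * (i + 2)) ^ (1 - s) := by
              refine Real.rpow_le_rpow (by positivity) ?_ (by linarith)
              gcongr; norm_num
          _ = ((i : ℝ) + 2) ^ (2 * (1 - s)) := by
              rw [Real.rpow_mul (by positivity)]; congr 1; norm_cast; ring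
          _ ≤ _ := Real.rpow_le_rpow_of_exponent_le hi2 (by linarith)
      · calc (((i : ℝ) + 2) * (i + 1)) ^ (1 - s) ≤ 1 :=
              Real.rpow_le_one_of_one_le_of_nonpos (by nlinarith) (by linarith)
          _ ≤ _ := Real.one_le_rpow hi2 (by linarith)
    have e2 : w (i + 2) =
        (B ^ 2 * ((((i : ℝ) + 2) * (i + 1)) ^ (1 - s) / (i + 2))) * w i := by
      simp only [hw, v]
      rw [Nat.factorial_succ (i + 1), Nat.factorial_succ i]
      push_cast
      rw [show ((i : ℝ) + 1 + 1) * ((i + 1) * (i ! : ℝ)) = (((i : ℝ) + 2) * (i + 1)) * (i ! : ℝ) by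
        ring, Real.mul_rpow (by positivity) (by positivity)]
      ring
    rw [e2]
    refine mul_le_of_le_one_left (w0 i) (le_trans ?_ h1)
    gcongr
  refine ⟨∑ i ∈ Finset.range (N + 2), w i + 1, ?_, ?_⟩
  · have := Finset.sum_nonneg (s := Finset.range (N + 2)) fun i _ => w0 i
    linarith
  · intro i
    induction i using Nat.strong_induction_on with
    | _ i ih =>
      by_cases hi : i < N + 2
      · have := Finset.single_le_sum (f := w) (fun i _ => w0 i) (Finset.mem_range.2 hi)
        change w i ≤ _
        linarith
      · obtain ⟨m, rfl⟩ : ∃ m, i = m + 2 := ⟨i - 2, by omega⟩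
        exact (step m (by omega)).trans (ih m (by omega))

lemma pow_bound (s μ h x : ℝ) (hs : 0 < s) (hμ : 0 < μ) (hh : 0 < h) (hx : 0 ≤ x) (j : ℕ) :
    x ^ j ≤ h ^ j * ((s / μ) ^ s) ^ j * (j ! : ℝ) ^ s *
      Real.exp (μ * h ^ (-(1 / s)) * x ^ (1 / s)) := by
  set y : ℝ := μ / s * (x / h) ^ (1 / s) with hy
  have hy0 : 0 ≤ y := by positivity
  have h1 : y ^ j ≤ (j ! : ℝ) * Real.exp y := by
    have := Real.pow_div_factorial_le_exp y hy0 j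
    rwa [div_le_iff₀ (by positivity), mul_comm] at this
  have h2 : (y ^ j) ^ s ≤ (j ! : ℝ) ^ s * Real.exp (y * s) := by
    rw [Real.exp_mul, ← Real.mul_rpow (by positivity) (by positivity)]
    exact Real.rpow_le_rpow (by positivity) h1 hs.le
  have h3 : (y ^ j) ^ s = (y ^ s) ^ j := by
    rw [← Real.rpow_natCast, ← Real.rpow_natCast, ← Real.rpow_mul hy0, ← Real.rpow_mul hy0,
      mul_comm]
  have h4 : h * (s / μ) ^ s * y ^ s = x := by
    rw [hy, Real.mul_rpow (by positivity) (by positivity), ← Real.rpow_mul (by positivity),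
      one_div_mul_cancel hs.ne', Real.rpow_one]
    have : (s / μ) ^ s * (μ / s) ^ s = 1 := by
      rw [← Real.mul_rpow (by positivity) (by positivity)]
      rw [show s / μ * (μ / s) = 1 by field_simp, Real.one_rpow]
    calc _ = ((s / μ) ^ s * (μ / s) ^ s) * (h * (x / h)) := by ring
      _ = x := by rw [this]; field_simp
  have h5 : y * s = μ * h ^ (-(1 / s)) * x ^ (1 / s) := by
    rw [hy, Real.div_rpow hx hh.le, Real.rpow_neg hh.le]
    field_simp
  rw [← h5]
  calc x ^ j = h ^ j * ((s / μ) ^ s) ^ j * (y ^ j) ^ s := by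
        rw [h3, ← mul_pow, ← mul_pow, h4]
    _ ≤ h ^ j * ((s / μ) ^ s) ^ j * ((j ! : ℝ) ^ s * Real.exp (y * s)) := by gcongr
    _ = _ := by ring

lemma fact_bound (s : ℝ) (hs : 0 < s) (j i : ℕ) :
    ((j + i)! : ℝ) ≤ ((j + i)! : ℝ) ^ s * ((j ! : ℝ) ^ (1 - s)) * (2 ^ (j + i) * (i ! : ℝ) ^ (1 - s)) := by
  have hpos : (0 : ℝ) < ((j + i)! : ℝ) := by positivity
  have e : ((j + i)! : ℝ) = ((j + i)! : ℝ) ^ s * ((j + i)! : ℝ) ^ (1 - s) := by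
    rw [← Real.rpow_add hpos]; simp
  have hc : ((j + i)! : ℝ) = ((j + i).choose j : ℝ) * ((j ! : ℝ) * (i ! : ℝ)) := by
    have := Nat.choose_mul_factorial_mul_factorial (Nat.le_add_right j i)
    rw [Nat.add_sub_cancel_left] at this
    rw [← this]; push_cast; ring
  have hc1 : (1 : ℝ) ≤ ((j + i).choose j : ℝ) := by
    exact_mod_cast Nat.choose_pos (by omega)
  have hc2 : ((j + i).choose j : ℝ) ≤ 2 ^ (j + i) := by
    exact_mod_cast Nat.choose_le_two_pow _ _
  have main : ((j + i)! : ℝ) ^ (1 - s) ≤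
      (j ! : ℝ) ^ (1 - s) * (2 ^ (j + i) * (i ! : ℝ) ^ (1 - s)) := by
    rw [hc, Real.mul_rpow (by positivity) (by positivity),
      Real.mul_rpow (by positivity) (by positivity)]
    have : ((j + i).choose j : ℝ) ^ (1 - s) ≤ 2 ^ (j + i) := by
      calc ((j + i).choose j : ℝ) ^ (1 - s) ≤ ((j + i).choose j : ℝ) ^ (1 : ℝ) :=
            Real.rpow_le_rpow_of_exponent_le hc1 (by linarith)
        _ ≤ _ := by rwa [Real.rpow_one]
    calc _ ≤ 2 ^ (j + i) * ((j ! : ℝ) ^ (1 - s) * (i ! : ℝ) ^ (1 - s)) := by gcongr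
      _ = _ := by ring
  calc ((j + i)! : ℝ) = ((j + i)! : ℝ) ^ s * ((j + i)! : ℝ) ^ (1 - s) := e
    _ ≤ ((j + i)! : ℝ) ^ s * ((j ! : ℝ) ^ (1 - s) * (2 ^ (j + i) * (i ! : ℝ) ^ (1 - s))) := by
        gcongr
    _ = _ := by ring

/-- The one dimensional estimate, with `δ` depending only on `s` and `μ`. -/
lemma one_dim (s μ : ℝ) (hs : 1 / 2 < s) (hμ : 0 < μ) :
    ∃ δ : ℝ, 0 < δ ∧ δ ≤ 1 ∧ ∀ h : ℝ, 0 < h → ∃ C : ℝ, 0 < C ∧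
      ∀ (l : ℂ), ‖l‖ ≤ δ → ∀ (x : ℝ) (k : ℕ),
        ‖P k l x‖ ≤ C * h ^ k * (k ! : ℝ) ^ s *
          Real.exp (μ * h ^ (-(1 / s)) * |x| ^ (1 / s)) := by
  have hs0 : 0 < s := by linarith
  set A : ℝ := (s / μ) ^ s with hA
  have hA0 : 0 < A := by positivity
  refine ⟨min 1 (1 / (4 * A)), by positivity, min_le_left _ _, fun h hh => ?_⟩
  obtain ⟨C, hC, hw⟩ := w_bdd s (2 / h) hs (by positivity)
  refine ⟨C * 2, by positivity, fun l hl x k => ?_⟩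
  set δ : ℝ := min 1 (1 / (4 * A)) with hδ
  have hδ0 : 0 < δ := by positivity
  have hδA : 2 * δ * A ≤ 1 / 2 := by
    have : δ ≤ 1 / (4 * A) := min_le_right _ _
    rw [le_div_iff₀ (by positivity)] at this
    linarith
  set E := Real.exp (μ * h ^ (-(1 / s)) * |x| ^ (1 / s)) with hE
  have hE0 : 0 < E := Real.exp_pos _
  have h1 := P_bound l x (δ * |x|) (hl.trans (min_le_left _ _)) (by
    rw [norm_mul, Complex.norm_real, Real.norm_eq_abs]; gcongr) k
  refine h1.trans ?_
  rw [F_coeff, Finset.mul_sum]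
  have term : ∀ p ∈ Finset.HasAntidiagonal.antidiagonal k,
      (k ! : ℝ) * ((δ * |x|) ^ p.1 / (p.1 ! : ℝ) * v p.2) ≤
        (C * h ^ k * (k ! : ℝ) ^ s * E) * (1 / 2) ^ p.1 := by
    rintro ⟨j, i⟩ hp
    obtain rfl : j + i = k := by simpa using hp
    have hx := pow_bound s μ h |x| hs0 hμ hh (abs_nonneg x) j
    have hf := fact_bound s hs0 j i
    have hwi := hw i
    have hv := v_nonneg i
    have hj : (j ! : ℝ) ^ (1 - s) * (j ! : ℝ) ^ s = (j ! : ℝ) := by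
      rw [← Real.rpow_add (by positivity)]; simp
    dsimp only
    have hd : (2 * δ * A) ^ j ≤ (1 / 2) ^ j := pow_le_pow_left₀ (by positivity) hδA j
    calc ((j + i)! : ℝ) * ((δ * |x|) ^ j / (j ! : ℝ) * v i)
        ≤ (((j + i)! : ℝ) ^ s * ((j ! : ℝ) ^ (1 - s)) * (2 ^ (j + i) * (i ! : ℝ) ^ (1 - s))) *
          ((δ ^ j * (h ^ j * A ^ j * (j ! : ℝ) ^ s * E)) / (j ! : ℝ) * v i) := by
          rw [mul_pow]; gcongr
      _ = ((j + i)! : ℝ) ^ s * (((j ! : ℝ) ^ (1 - s) * (j ! : ℝ) ^ s) / (j ! : ℝ)) * h ^ (j + i) *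
          E * (2 * δ * A) ^ j * ((2 / h) ^ i * (i ! : ℝ) ^ (1 - s) * v i) := by
          have : h ^ i * (2 / h) ^ i = 2 ^ i := by rw [← mul_pow]; congr 1; field_simp
          rw [pow_add 2, pow_add h, ← this]
          ring
      _ ≤ ((j + i)! : ℝ) ^ s * 1 * h ^ (j + i) * E * (1 / 2) ^ j * C := by
          rw [hj, div_self (by positivity)]
          have : 0 ≤ (2 / h) ^ i * (i ! : ℝ) ^ (1 - s) * v i := by positivity
          gcongr
      _ = _ := by ring
  refine (Finset.sum_le_sum term).trans ?_
  rw [← Finset.mul_sum, Finset.Nat.sum_antidiagonal_eq_sum_range_succ_mk]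
  have hg : ∑ j ∈ Finset.range (k + 1), (1 / 2 : ℝ) ^ j ≤ 2 := sum_geometric_two_le (k + 1)
  calc _ ≤ (C * h ^ k * (k ! : ℝ) ^ s * E) * 2 := by gcongr
    _ = _ := by ring

/-- The estimate in its strong form: `δ` depends only on `n`, `s`, `μ`, and `C` only on
`n`, `s`, `μ`, `h`. -/
theorem strong (n : ℕ) (hn : 1 ≤ n) (s : ℝ) (hs : 1 / 2 < s) (μ : ℝ) (hμ : 0 < μ) :
    ∃ δ : ℝ, 0 < δ ∧ δ ≤ 1 ∧ ∀ h : ℝ, 0 < h → ∃ C : ℝ, 0 < C ∧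
      ∀ (Λ : Fin n → ℂ), (∀ j, ‖Λ j‖ ≤ δ) →
        ∀ (z : EuclideanSpace ℝ (Fin n)) (α : Fin n → ℕ),
          ‖pdMulti α (fun w => Complex.exp ((1 / 2 : ℂ) * ∑ j, Λ j * (w j : ℂ) ^ 2)) z‖ ≤
            C * h ^ (∑ j, α j) * (∏ j, ((α j)! : ℝ)) ^ s *
              Real.exp (μ * h ^ (-(1 / s)) * ‖z‖ ^ (1 / s)) *
              ‖Complex.exp ((1 / 2 : ℂ) * ∑ j, Λ j * (z j : ℂ) ^ 2)‖ := by
  have hn0 : (0 : ℝ) < n := by exact_mod_cast hn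
  have hs0 : 0 < s := by linarith
  obtain ⟨δ, hδ, hδ1, H⟩ := one_dim s (μ / n) hs (by positivity)
  refine ⟨δ, hδ, hδ1, fun h hh => ?_⟩
  obtain ⟨C, hC, H⟩ := H h hh
  refine ⟨C ^ n, by positivity, fun Λ hΛ z α => ?_⟩
  rw [pdMulti_eq, norm_mul, norm_prod]
  gcongr
  have hb : ∀ i ∈ Finset.univ, ‖P (α i) (Λ i) (z i)‖ ≤ C * h ^ (α i) * ((α i)! : ℝ) ^ s *
      Real.exp (μ / n * h ^ (-(1 / s)) * ‖z‖ ^ (1 / s)) := by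
    intro i _
    refine (H (Λ i) (hΛ i) (z i) (α i)).trans ?_
    have : |z i| ≤ ‖z‖ := by simpa using PiLp.norm_apply_le z i
    gcongr
  refine (Finset.prod_le_prod (fun i _ => norm_nonneg _) hb).trans (le_of_eq ?_)
  rw [Finset.prod_mul_distrib, Finset.prod_mul_distrib, Finset.prod_mul_distrib,
    Finset.prod_pow_eq_pow_sum, Real.finsetProd_rpow _ _ (fun i _ => by positivity),
    Finset.prod_const, Finset.prod_const, Finset.card_univ, Fintype.card_fin, ← Real.exp_nat_mul]
  congr 2
  field_simp

end GaussEst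

/-- Let `λ > 0`, `s > 1/2`, `n ≥ 1` and let `Λ` be a diagonal complex matrix
(given by its diagonal entries `Λ j`) with `|Λ j| ≤ λ`, and `g(z) = exp(½ ∑ⱼ Λⱼ zⱼ²)`.
For each `μ > 0` there exists `0 < δ ≤ 1` such that if `λ ≤ δ` then for every `h > 0` there is
`C > 0` with `|∂^α g(z)| ≤ C h^{|α|} (α!)^s exp(μ h^{−1/s} |z|^{1/s}) |g(z)|` for all `z, α`. -/
theorem gaussian_diagonal_estimate (n : ℕ) (hn : 1 ≤ n) (lam s : ℝ) (hlam : 0 < lam)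
    (hs : 1 / 2 < s) (Λ : Fin n → ℂ) (hΛ : ∀ j, ‖Λ j‖ ≤ lam)
    (μ : ℝ) (hμ : 0 < μ) :
    ∃ δ : ℝ, 0 < δ ∧ δ ≤ 1 ∧
      (lam ≤ δ → ∀ h : ℝ, 0 < h → ∃ C : ℝ, 0 < C ∧
        ∀ (z : EuclideanSpace ℝ (Fin n)) (α : Fin n → ℕ),
          ‖pdMulti α (fun w => Complex.exp ((1 / 2 : ℂ) * ∑ j, Λ j * (w j : ℂ) ^ 2)) z‖ ≤
            C * h ^ (∑ j, α j) * (∏ j, ((α j)! : ℝ)) ^ s *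
              Real.exp (μ * h ^ (-(1 / s)) * ‖z‖ ^ (1 / s)) *
              ‖Complex.exp ((1 / 2 : ℂ) * ∑ j, Λ j * (z j : ℂ) ^ 2)‖) := by
  obtain ⟨δ, hδ, hδ1, H⟩ := GaussEst.strong n hn s hs μ hμ
  refine ⟨δ, hδ, hδ1, fun hl h hh => ?_⟩
  obtain ⟨C, hC, H⟩ := H h hh
  exact ⟨C, hC, H Λ (fun j => (hΛ j).trans hl)⟩
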